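/- Let $(a_\ell)_{\ell \in \mathbb{N}_0}$ be a sequence of nonnegative reals. If there exists a constant $C > 0$ such that $\sum_{k=\ell+1}^{\infty} a_k^2 \le C a_\ell^2$ for all $\ell \in \mathbb{N}_0$, then there exist constants $C' > 0$ and $0 < \rho < 1$ such that $a_{\ell+k}^2 \le C' \rho^k a_\ell^2$ for all $k, \ell \in \mathbb{N}_0$. Specifically one may take $\rho = (1 + C^{-1})^{-1}$ and $C' = 1 + C$. -/

import Mathlib

/-- Lemma 4.7 (i) ⟹ (iii): uniform summability of tails implies R-linear convergence,
with `ρ = (1 + C⁻¹)⁻¹` and `C' = 1 + C`. -/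
theorem tail_summability_implies_Rlinear
    (a : ℕ → ℝ) (ha : ∀ ℓ, 0 ≤ a ℓ) (C : ℝ) (hC : 0 < C)
    (hsum : ∀ ℓ, Summable (fun k : ℕ => (a (ℓ + 1 + k)) ^ 2))
    (hbound : ∀ ℓ, (∑' k : ℕ, (a (ℓ + 1 + k)) ^ 2) ≤ C * (a ℓ) ^ 2) :
    ∃ C' > 0, ∃ ρ : ℝ, 0 < ρ ∧ ρ < 1 ∧
      C' = 1 + C ∧ ρ = (1 + C⁻¹)⁻¹ ∧
      ∀ k ℓ : ℕ, (a (ℓ + k)) ^ 2 ≤ C' * ρ ^ k * (a ℓ) ^ 2 := by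
  have hS : ∀ ℓ, Summable (fun k : ℕ => (a (ℓ + k)) ^ 2) := by
    intro ℓ
    rw [← summable_nat_add_iff 1]
    refine (hsum ℓ).congr (fun k => ?_)
    rw [show ℓ + (k + 1) = ℓ + 1 + k by ring]
  have hsplit : ∀ ℓ, (∑' k : ℕ, (a (ℓ + k)) ^ 2)
      = (a ℓ) ^ 2 + ∑' k : ℕ, (a (ℓ + 1 + k)) ^ 2 := by
    intro ℓ
    rw [(hS ℓ).tsum_eq_zero_add, add_zero]
    congr 1
    refine tsum_congr (fun k => ?_)
    rw [show ℓ + (k + 1) = ℓ + 1 + k by ring]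
  have hρ : (1 + C⁻¹)⁻¹ = C / (1 + C) := by
    field_simp
    ring
  have hρ0 : 0 < (1 + C⁻¹)⁻¹ := by positivity
  have hstep : ∀ ℓ, (∑' k : ℕ, (a (ℓ + 1 + k)) ^ 2)
      ≤ (1 + C⁻¹)⁻¹ * ∑' k : ℕ, (a (ℓ + k)) ^ 2 := by
    intro ℓ
    rw [hρ, hsplit ℓ, div_mul_eq_mul_div, le_div_iff₀ (by positivity)]
    linarith [hbound ℓ]
  have hiter : ∀ k ℓ, (∑' j : ℕ, (a (ℓ + k + j)) ^ 2)
      ≤ (1 + C⁻¹)⁻¹ ^ k * ∑' j : ℕ, (a (ℓ + j)) ^ 2 := by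
    intro k ℓ
    induction k with
    | zero => simp
    | succ k ih =>
      calc (∑' j : ℕ, (a (ℓ + k + 1 + j)) ^ 2)
          ≤ (1 + C⁻¹)⁻¹ * ∑' j : ℕ, (a (ℓ + k + j)) ^ 2 := hstep (ℓ + k)
        _ ≤ (1 + C⁻¹)⁻¹ * ((1 + C⁻¹)⁻¹ ^ k * ∑' j : ℕ, (a (ℓ + j)) ^ 2) :=
          mul_le_mul_of_nonneg_left ih hρ0.le
        _ = _ := by ring
  refine ⟨1 + C, by positivity, (1 + C⁻¹)⁻¹, hρ0, ?_, rfl, rfl, ?_⟩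
  · rw [hρ, div_lt_one (by positivity)]
    linarith
  · intro k ℓ
    have h1 : (a (ℓ + k)) ^ 2 ≤ ∑' j : ℕ, (a (ℓ + k + j)) ^ 2 := by
      rw [hsplit]
      have : 0 ≤ ∑' j : ℕ, (a (ℓ + k + 1 + j)) ^ 2 := tsum_nonneg (fun j => sq_nonneg _)
      linarith
    have h2 : (∑' j : ℕ, (a (ℓ + j)) ^ 2) ≤ (1 + C) * (a ℓ) ^ 2 := by
      rw [hsplit]
      linarith [hbound ℓ]
    calc (a (ℓ + k)) ^ 2 ≤ _ := h1
      _ ≤ _ := hiter k ℓ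
      _ ≤ (1 + C⁻¹)⁻¹ ^ k * ((1 + C) * (a ℓ) ^ 2) :=
        mul_le_mul_of_nonneg_left h2 (pow_nonneg hρ0.le k)
      _ = _ := by ring
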